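/- arXiv:2408.13258 — 2 statements merged into one kernel-verified Lean document; each statement's English description precedes it below -/
import Mathlib

section
/- Let g be in normal form, fix n ≥ 1, and assume a_{i,1} = 0 for 2 ≤ i ≤ n (no condition when n = 1) and a_{n+1,1} ≠ 0. Let θ₀ ∈ (−π/2, π/2), A(θ₀) = √(a_{n+1,1}² cos²θ₀ + ((n+1)!)² sin²θ₀), and ν₀ = σ·(0, −a_{n+1,1} cosθ₀ / A(θ₀), (n+1)! sinθ₀ / A(θ₀)) for a sign σ ∈ {1,−1}. Then the height function h_{ν₀} has an A₃ singularity at (0,0) if and only if a_{n+1,1} b₂ cosθ₀ − (n+1)! a_{2,0} sinθ₀ = 0, a_{n+1,1} b₃ cosθ₀ − (n+1)! a_{3,0} sinθ₀ = 0, and a_{n+1,1}(a_{n+1,1} b₄ cosθ₀ − (n+1)! a_{4,0} sinθ₀) cosθ₀ − 3 ((n+1)!)² a_{2,1}² sin²θ₀ ≠ 0 (parabolic point which is a first-order ridge point over the singularity). -/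
open Real Set

noncomputable section

/-- Partial derivative in the first variable. -/
def pdu {F : Type*} [NormedAddCommGroup F] [NormedSpace ℝ F] (f : ℝ → ℝ → F) : ℝ → ℝ → F :=
  fun u w => deriv (fun t => f t w) u

/-- Partial derivative in the second variable. -/
def pdw {F : Type*} [NormedAddCommGroup F] [NormedSpace ℝ F] (f : ℝ → ℝ → F) : ℝ → ℝ → F :=
  fun u w => deriv (fun t => f u t) w

/-- Iterated partial derivative `∂_u^i ∂_w^j f`. -/
def pd {F : Type*} [NormedAddCommGroup F] [NormedSpace ℝ F] (i j : ℕ) (f : ℝ → ℝ → F) :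
    ℝ → ℝ → F :=
  pdu^[i] (pdw^[j] f)

/-- The Euclidean inner product on `ℝ³ = ℝ × ℝ × ℝ`. -/
def dot3 (x y : ℝ × ℝ × ℝ) : ℝ := x.1 * y.1 + x.2.1 * y.2.1 + x.2.2 * y.2.2

/-- The cross product on `ℝ³ = ℝ × ℝ × ℝ`. -/
def cross3 (x y : ℝ × ℝ × ℝ) : ℝ × ℝ × ℝ :=
  (x.2.1 * y.2.2 - x.2.2 * y.2.1, x.2.2 * y.1 - x.1 * y.2.2, x.1 * y.2.1 - x.2.1 * y.1)

/-- The Euclidean norm on `ℝ³ = ℝ × ℝ × ℝ`. -/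
def norm3 (x : ℝ × ℝ × ℝ) : ℝ := Real.sqrt (dot3 x x)

/-- The surface parameterization `g(u,w) = (u, p(u,w), q(u,w))`. -/
def gmap (p q : ℝ → ℝ → ℝ) : ℝ → ℝ → ℝ × ℝ × ℝ := fun u w => (u, p u w, q u w)

/-- The height function on the surface parameterized by `g = (u, p, q)` along `v`. -/
def hgt (p q : ℝ → ℝ → ℝ) (v : ℝ × ℝ × ℝ) : ℝ → ℝ → ℝ :=
  fun u w => dot3 (gmap p q u w) v

/-- `g = (u, p(u,w), q(u,w))` is in normal form of order `N`. -/
def NormalFormN (N : ℕ) (p q : ℝ → ℝ → ℝ) (b : ℕ → ℝ) (a : ℕ → ℕ → ℝ) : Prop :=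
  ContDiff ℝ (⊤ : ℕ∞) (fun x : ℝ × ℝ => p x.1 x.2) ∧
  ContDiff ℝ (⊤ : ℕ∞) (fun x : ℝ × ℝ => q x.1 x.2) ∧
  p 0 0 = 0 ∧ q 0 0 = 0 ∧
  pd 1 0 p 0 0 = 0 ∧ pd 0 1 p 0 0 = 0 ∧ pd 1 0 q 0 0 = 0 ∧ pd 0 1 q 0 0 = 0 ∧
  pd 0 2 p 0 0 = 1 ∧
  (∀ i, 2 ≤ i → i ≤ N → pd i 0 p 0 0 = b i) ∧
  (∀ i j, 2 ≤ i + j → i + j ≤ N → 1 ≤ j → ¬(i = 0 ∧ j = 2) → pd i j p 0 0 = 0) ∧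
  (∀ i j, 2 ≤ i + j → i + j ≤ N → pd i j q 0 0 = a i j) ∧
  a 1 1 = 0 ∧ a 0 2 = 0

/-- `h` has an `A_k` singularity at the origin: up to a `C^∞` change of coordinates fixing
the origin, `h` equals `h(0,0) ± x² ± y^(k+1)`. -/
def HasAkSingAt (h : ℝ → ℝ → ℝ) (k : ℕ) : Prop :=
  ∃ (U V : Set (ℝ × ℝ)) (φ ψ : ℝ × ℝ → ℝ × ℝ) (ε₁ ε₂ : ℝ),
    IsOpen U ∧ IsOpen V ∧ ((0, 0) : ℝ × ℝ) ∈ U ∧ ((0, 0) : ℝ × ℝ) ∈ V ∧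
    ContDiffOn ℝ (⊤ : ℕ∞) φ U ∧ ContDiffOn ℝ (⊤ : ℕ∞) ψ V ∧
    Set.MapsTo φ U V ∧ Set.MapsTo ψ V U ∧
    (∀ x ∈ U, ψ (φ x) = x) ∧ (∀ y ∈ V, φ (ψ y) = y) ∧
    φ (0, 0) = (0, 0) ∧ (ε₁ = 1 ∨ ε₁ = -1) ∧ (ε₂ = 1 ∨ ε₂ = -1) ∧
    ∀ x ∈ U, h (φ x).1 (φ x).2 = h 0 0 + ε₁ * x.1 ^ 2 + ε₂ * x.2 ^ (k + 1)

/-- The parabolic-set function `Σ = ⟨g_uu, g_u × g_w⟩⟨g_ww, g_u × g_w⟩ − ⟨g_uw, g_u × g_w⟩²`. -/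
def SigmaFun (p q : ℝ → ℝ → ℝ) : ℝ → ℝ → ℝ := fun u w =>
  dot3 (pd 2 0 (gmap p q) u w) (cross3 (pd 1 0 (gmap p q) u w) (pd 0 1 (gmap p q) u w)) *
      dot3 (pd 0 2 (gmap p q) u w) (cross3 (pd 1 0 (gmap p q) u w) (pd 0 1 (gmap p q) u w)) -
    dot3 (pd 1 1 (gmap p q) u w) (cross3 (pd 1 0 (gmap p q) u w) (pd 0 1 (gmap p q) u w)) ^ 2

/-- The torsion of a space curve `L`. -/
def tor (L : ℝ → ℝ × ℝ × ℝ) : ℝ → ℝ := fun t =>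
  dot3 (cross3 (deriv L t) (deriv (deriv L) t)) (deriv (deriv (deriv L)) t) /
    norm3 (cross3 (deriv L t) (deriv (deriv L) t)) ^ 2

/-- The unit binormal vector of a space curve `L` at `t = 0`. -/
def binormal0 (L : ℝ → ℝ × ℝ × ℝ) : ℝ × ℝ × ℝ :=
  (norm3 (cross3 (deriv L 0) (deriv (deriv L) 0)))⁻¹ • cross3 (deriv L 0) (deriv (deriv L) 0)

/-- `f` is a parabolic Monge form with `∂_w² f(0,0) = k₂ ≠ 0`. -/
def MongeForm (f : ℝ → ℝ → ℝ) (k₂ : ℝ) : Prop :=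
  ContDiff ℝ (⊤ : ℕ∞) (fun x : ℝ × ℝ => f x.1 x.2) ∧ f 0 0 = 0 ∧
  pd 1 0 f 0 0 = 0 ∧ pd 0 1 f 0 0 = 0 ∧
  pd 2 0 f 0 0 = 0 ∧ pd 1 1 f 0 0 = 0 ∧ pd 0 2 f 0 0 = k₂ ∧ k₂ ≠ 0

/-- The parabolic-set function `P = f_uu f_ww − f_uw²` of a Monge form. -/
def Pfun (f : ℝ → ℝ → ℝ) : ℝ → ℝ → ℝ := fun u w =>
  pd 2 0 f u w * pd 0 2 f u w - pd 1 1 f u w ^ 2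


/-- Integrals over `[0, 1]` of smooth functions depend smoothly on parameters. -/
theorem contDiff_integral_unitInterval_of_contDiff {E : Type} [NormedAddCommGroup E]
    [NormedSpace ℝ E] [ProperSpace E] (n : ℕ) {G : Type} [NormedAddCommGroup G]
    [NormedSpace ℝ G] [CompleteSpace G] {F : E × ℝ → G} (hF : ContDiff ℝ (⊤ : ℕ∞) F) :
    ContDiff ℝ n (fun x => ∫ t in (0 : ℝ)..1, F (x, t)) := by
  induction n generalizing G with
  | zero =>
    exact contDiff_zero.2
      (intervalIntegral.continuous_parametric_intervalIntegral_of_continuous'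
        (f := fun x t => F (x, t)) hF.continuous 0 1)
  | succ n ih =>
    have hF' : ContDiff ℝ (⊤ : ℕ∞)
        (fun z : E × ℝ => (fderiv ℝ F z).comp (ContinuousLinearMap.inl ℝ E ℝ)) :=
      (hF.fderiv_right (m := (⊤ : ℕ∞)) (by simp)).clm_comp contDiff_const
    push_cast
    rw [contDiff_succ_iff_hasFDerivAt (n := n)]
    refine ⟨fun x => ∫ t in (0 : ℝ)..1,
      (fderiv ℝ F (x, t)).comp (ContinuousLinearMap.inl ℝ E ℝ), by simpa using ih hF', fun x => ?_⟩
    obtain ⟨C, hC⟩ := ((isCompact_closedBall x 1).prod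
      (isCompact_Icc (a := (0 : ℝ)) (b := 1))).exists_bound_of_continuousOn hF'.continuous.continuousOn
    refine (intervalIntegral.hasFDerivAt_integral_of_dominated_of_fderiv_le
      (F := fun y t => F (y, t))
      (F' := fun y t => (fderiv ℝ F (y, t)).comp (ContinuousLinearMap.inl ℝ E ℝ))
      (bound := fun _ => C) (Metric.ball_mem_nhds x one_pos) ?_ ?_ ?_ ?_ ?_ ?_)
    · exact Filter.Eventually.of_forall fun y =>
        (hF.continuous.comp (Continuous.prodMk_right y)).aestronglyMeasurable
    · exact (hF.continuous.comp (Continuous.prodMk_right x)).intervalIntegrable _ _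
    · exact (hF'.continuous.comp (Continuous.prodMk_right x)).aestronglyMeasurable
    · refine Filter.Eventually.of_forall fun t ht y hy => hC (y, t) ⟨Metric.ball_subset_closedBall hy, ?_⟩
      rw [Set.uIoc_of_le zero_le_one] at ht
      exact Ioc_subset_Icc_self ht
    · exact intervalIntegrable_const
    · refine Filter.Eventually.of_forall fun t _ y _ => ?_
      exact ((hF.differentiable (by simp)) (y, t)).hasFDerivAt.comp y (hasFDerivAt_prodMk_left y t)

/-- Hadamard's lemma in the second variable. -/
theorem exists_contDiff_eq_add_mul {f : ℝ × ℝ → ℝ} (hf : ContDiff ℝ (⊤ : ℕ∞) f) :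
    ∃ g : ℝ × ℝ → ℝ, ContDiff ℝ (⊤ : ℕ∞) g ∧ ∀ u w, f (u, w) = f (u, 0) + w * g (u, w) := by
  have hF : ContDiff ℝ (⊤ : ℕ∞) (fun z : (ℝ × ℝ) × ℝ => fderiv ℝ f (z.1.1, z.2 * z.1.2) (0, 1)) := by
    have h1 := hf.fderiv_right (m := (⊤ : ℕ∞)) (by simp)
    exact (h1.comp (by fun_prop : ContDiff ℝ (⊤ : ℕ∞)
      (fun z : (ℝ × ℝ) × ℝ => (z.1.1, z.2 * z.1.2)))).clm_apply contDiff_const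
  refine ⟨fun x => ∫ t in (0 : ℝ)..1, fderiv ℝ f (x.1, t * x.2) (0, 1),
    contDiff_infty.2 fun n => contDiff_integral_unitInterval_of_contDiff n hF, fun u w => ?_⟩
  have hd : ∀ t : ℝ, HasDerivAt (fun t : ℝ => f (u, t * w)) (w * fderiv ℝ f (u, t * w) (0, 1)) t := by
    intro t
    have h1 : HasDerivAt (fun t : ℝ => (u, t * w)) ((0 : ℝ), w) t := by
      simpa using (hasDerivAt_const t u).prodMk ((hasDerivAt_id t).mul_const w)
    have h2 := ((hf.differentiable (by simp)) (u, t * w)).hasFDerivAt.comp_hasDerivAt t h1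
    have h3 : ((0 : ℝ), w) = w • ((0 : ℝ), (1 : ℝ)) := by simp
    rw [h3, map_smul, smul_eq_mul] at h2
    exact h2
  have hc : Continuous fun t : ℝ => w * fderiv ℝ f (u, t * w) (0, 1) :=
    continuous_const.mul (hF.continuous.comp (Continuous.prodMk_right (u, w)))
  have := intervalIntegral.integral_eq_sub_of_hasDerivAt (a := 0) (b := 1) (fun t _ => hd t)
    (hc.intervalIntegrable _ _)
  rw [intervalIntegral.integral_const_mul] at this
  simp only [one_mul, zero_mul] at this
  linarith

theorem exists_contDiff_eq_mul {f : ℝ → ℝ} (hf : ContDiff ℝ (⊤ : ℕ∞) f) (h0 : f 0 = 0) :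
    ∃ g : ℝ → ℝ, ContDiff ℝ (⊤ : ℕ∞) g ∧ f = fun t => t * g t := by
  obtain ⟨g, hg, h⟩ := exists_contDiff_eq_add_mul (hf.comp contDiff_snd)
  refine ⟨fun t => g (0, t), hg.comp (by fun_prop), funext fun t => ?_⟩
  simpa [h0] using h 0 t

theorem iteratedDeriv_succ_id_mul {g : ℝ → ℝ} (hg : ContDiff ℝ (⊤ : ℕ∞) g) (k : ℕ) :
    iteratedDeriv (k + 1) (fun t => t * g t) =
      fun t => (k + 1) * iteratedDeriv k g t + t * iteratedDeriv (k + 1) g t := by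
  have hd : ∀ (m : ℕ) (t : ℝ),
      HasDerivAt (iteratedDeriv m g) (iteratedDeriv (m + 1) g t) t := fun m t => by
    rw [iteratedDeriv_succ]
    exact ((hg.differentiable_iteratedDeriv m (by exact_mod_cast WithTop.coe_lt_top m)) t).hasDerivAt
  induction k with
  | zero =>
    ext t
    rw [iteratedDeriv_one]
    refine ((hasDerivAt_id t).mul (hd 0 t)).deriv.trans ?_
    simp
  | succ k ih =>
    ext t
    rw [iteratedDeriv_succ, ih]
    refine (((hd k t).const_mul _).add ((hasDerivAt_id t).mul (hd (k + 1) t))).deriv.trans ?_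
    push_cast
    simp
    ring

theorem iteratedDeriv_succ_id_mul_zero {g : ℝ → ℝ} (hg : ContDiff ℝ (⊤ : ℕ∞) g) (k : ℕ) :
    iteratedDeriv (k + 1) (fun t => t * g t) 0 = (k + 1) * iteratedDeriv k g 0 := by
  simp [iteratedDeriv_succ_id_mul hg]

theorem exists_contDiff_eq_pow_mul {f : ℝ → ℝ} (hf : ContDiff ℝ (⊤ : ℕ∞) f) (k : ℕ)
    (h0 : ∀ i < k, iteratedDeriv i f 0 = 0) :
    ∃ g : ℝ → ℝ, ContDiff ℝ (⊤ : ℕ∞) g ∧ f = fun t => t ^ k * g t := by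
  induction k generalizing f with
  | zero => exact ⟨f, hf, by simp⟩
  | succ k ih =>
    obtain ⟨g, hg, rfl⟩ := exists_contDiff_eq_mul hf (by simpa using h0 0 (by omega))
    obtain ⟨g', hg', rfl⟩ := ih hg fun i hi => by
      have := h0 (i + 1) (by omega)
      rw [iteratedDeriv_succ_id_mul_zero hg] at this
      exact (mul_eq_zero.1 this).resolve_left (by positivity)
    exact ⟨g', hg', by ext t; ring⟩

/-- A function `t ^ k * g t` has vanishing derivatives of order below `k` at `0`. -/
theorem iteratedDeriv_pow_mul_zero {g : ℝ → ℝ} (hg : ContDiff ℝ (⊤ : ℕ∞) g) (k : ℕ) :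
    (∀ i < k, iteratedDeriv i (fun t => t ^ k * g t) 0 = 0) ∧
      iteratedDeriv k (fun t => t ^ k * g t) 0 = k.factorial * g 0 := by
  induction k with
  | zero => simp
  | succ k ih =>
    have hs : (fun t : ℝ => t ^ (k + 1) * g t) = fun t => t * (t ^ k * g t) := by ext t; ring
    have hk : ContDiff ℝ (⊤ : ℕ∞) (fun t : ℝ => t ^ k * g t) := by fun_prop
    rw [hs]
    refine ⟨fun i hi => ?_, ?_⟩
    · cases i with
      | zero => simp
      | succ i => rw [iteratedDeriv_succ_id_mul_zero hk, ih.1 i (by omega), mul_zero]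
    · rw [iteratedDeriv_succ_id_mul_zero hk, ih.2, Nat.factorial_succ]
      push_cast
      ring

/-- A smooth germ on an open set extends to a globally smooth function. -/
theorem exists_contDiff_eventuallyEq {E F : Type*} [NormedAddCommGroup E] [NormedSpace ℝ E]
    [FiniteDimensional ℝ E] [NormedAddCommGroup F] [NormedSpace ℝ F] {f : E → F} {V : Set E}
    {x : E} (hV : IsOpen V) (hx : x ∈ V) (hf : ContDiffOn ℝ (⊤ : ℕ∞) f V) :
    ∃ g : E → F, ContDiff ℝ (⊤ : ℕ∞) g ∧ g =ᶠ[nhds x] f := by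
  obtain ⟨r, hr, hrV⟩ := Metric.nhds_basis_closedBall.mem_iff.1 (hV.mem_nhds hx)
  let c : ContDiffBump x := ⟨r / 2, r, half_pos hr, half_lt_self hr⟩
  refine ⟨fun y => c y • f y, contDiff_iff_contDiffAt.2 fun y => ?_, ?_⟩
  · by_cases hy : y ∈ V
    · exact c.contDiffAt.smul (hf.contDiffAt (hV.mem_nhds hy))
    · have hy' : y ∉ tsupport c := fun h => hy (hrV (by rwa [c.tsupport_eq] at h))
      refine (contDiffAt_const (c := (0 : F))).congr_of_eventuallyEq ?_
      filter_upwards [notMem_tsupport_iff_eventuallyEq.1 hy'] with z hz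
      simp [hz]
  · filter_upwards [c.eventuallyEq_one] with y hy
    simp [hy]

theorem pd_zero_right (f : ℝ → ℝ → ℝ) (i : ℕ) (u w : ℝ) :
    pd i 0 f u w = iteratedDeriv i (fun t => f t w) u := by
  induction i generalizing u with
  | zero => simp [pd]
  | succ i ih =>
    rw [iteratedDeriv_succ, ← funext ih]
    simp only [pd, Function.iterate_succ_apply']
    rfl

theorem pd_eq_pd_pdw (f : ℝ → ℝ → ℝ) (i j : ℕ) : pd i (j + 1) f = pd i j (pdw f) := by
  simp [pd]

theorem pdw_eq_fderiv {f : ℝ × ℝ → ℝ} (hf : ContDiff ℝ (⊤ : ℕ∞) f) (u w : ℝ) :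
    pdw (fun u w => f (u, w)) u w = fderiv ℝ f (u, w) (0, 1) :=
  (((hf.differentiable (by simp)) (u, w)).hasFDerivAt.comp_hasDerivAt w
    ((hasDerivAt_const w u).prodMk (hasDerivAt_id w))).deriv

theorem pdu_eq_fderiv {f : ℝ × ℝ → ℝ} (hf : ContDiff ℝ (⊤ : ℕ∞) f) (u w : ℝ) :
    pdu (fun u w => f (u, w)) u w = fderiv ℝ f (u, w) (1, 0) :=
  (((hf.differentiable (by simp)) (u, w)).hasFDerivAt.comp_hasDerivAt u
    ((hasDerivAt_id u).prodMk (hasDerivAt_const u w))).deriv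

theorem contDiff_pdw {f : ℝ × ℝ → ℝ} (hf : ContDiff ℝ (⊤ : ℕ∞) f) :
    ContDiff ℝ (⊤ : ℕ∞) (fun z : ℝ × ℝ => pdw (fun u w => f (u, w)) z.1 z.2) := by
  simp only [pdw_eq_fderiv hf]
  exact (hf.fderiv_right (m := (⊤ : ℕ∞)) (by simp)).clm_apply contDiff_const

/-- Necessary conditions on the partial derivatives of a germ of the form `c₀ ± X² ± Y⁴`. -/
theorem pd_conditions_of_eventuallyEq {H X Y : ℝ × ℝ → ℝ} {c₀ ε₁ ε₂ : ℝ}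
    (hH : ContDiff ℝ (⊤ : ℕ∞) H) (hX : ContDiff ℝ (⊤ : ℕ∞) X) (hY : ContDiff ℝ (⊤ : ℕ∞) Y)
    (hX0 : X (0, 0) = 0) (hY0 : Y (0, 0) = 0) (hε₁ : ε₁ = 1 ∨ ε₁ = -1) (hε₂ : ε₂ = 1 ∨ ε₂ = -1)
    (hHXY : H =ᶠ[nhds (0, 0)] fun z => c₀ + ε₁ * X z ^ 2 + ε₂ * Y z ^ 4)
    (hXY : fderiv ℝ X (0, 0) (1, 0) = 0 → fderiv ℝ Y (0, 0) (1, 0) ≠ 0)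
    (h11 : pd 1 1 (fun u w => H (u, w)) 0 0 = 0) (h02 : pd 0 2 (fun u w => H (u, w)) 0 0 ≠ 0) :
    pd 2 0 (fun u w => H (u, w)) 0 0 = 0 ∧ pd 3 0 (fun u w => H (u, w)) 0 0 = 0 ∧
      pd 4 0 (fun u w => H (u, w)) 0 0 * pd 0 2 (fun u w => H (u, w)) 0 0 -
        3 * pd 2 1 (fun u w => H (u, w)) 0 0 ^ 2 ≠ 0 := by
  have hXd := hX.differentiable (by simp)
  have hYd := hY.differentiable (by simp)
  set M : ℝ × ℝ → ℝ := fun z => fderiv ℝ X z (0, 1) with hM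
  set N : ℝ × ℝ → ℝ := fun z => fderiv ℝ Y z (0, 1) with hN
  have hMc : ContDiff ℝ (⊤ : ℕ∞) M :=
    (hX.fderiv_right (m := (⊤ : ℕ∞)) (by simp)).clm_apply contDiff_const
  have hNc : ContDiff ℝ (⊤ : ℕ∞) N :=
    (hY.fderiv_right (m := (⊤ : ℕ∞)) (by simp)).clm_apply contDiff_const
  have hw : (fun z : ℝ × ℝ => pdw (fun u w => H (u, w)) z.1 z.2) =ᶠ[nhds (0, 0)]
      fun z => 2 * ε₁ * X z * M z + 4 * ε₂ * Y z ^ 3 * N z := by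
    filter_upwards [hHXY.fderiv (𝕜 := ℝ)] with z hz
    rw [pdw_eq_fderiv hH, hz]
    have := ((((hXd z).hasFDerivAt.pow 2).const_mul ε₁).const_add c₀).add
      (((hYd z).hasFDerivAt.pow 4).const_mul ε₂)
    refine (congrArg (fun L : ℝ × ℝ →L[ℝ] ℝ => L (0, 1)) this.fderiv).trans ?_
    simp [hM, hN]
    ring
  have ht : Filter.Tendsto (fun t : ℝ => (t, (0 : ℝ))) (nhds 0) (nhds (0, 0)) :=
    (Continuous.prodMk_left 0).tendsto' _ _ rfl
  have ht' : Filter.Tendsto (fun t : ℝ => ((0 : ℝ), t)) (nhds 0) (nhds (0, 0)) :=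
    (Continuous.prodMk_right 0).tendsto' _ _ rfl
  obtain ⟨x₁, hx₁, hx⟩ := exists_contDiff_eq_mul (f := fun t => X (t, 0)) (hX.comp (by fun_prop)) hX0
  obtain ⟨y₁, hy₁, hy⟩ := exists_contDiff_eq_mul (f := fun t => Y (t, 0)) (hY.comp (by fun_prop)) hY0
  have key : ∀ {F : ℝ × ℝ → ℝ} {f : ℝ → ℝ}, ContDiff ℝ (⊤ : ℕ∞) F → ContDiff ℝ (⊤ : ℕ∞) f →
      (fun t => F (t, 0)) = (fun t => t * f t) → fderiv ℝ F (0, 0) (1, 0) = f 0 := by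
    intro F f hF hf h
    rw [← pdu_eq_fderiv hF, pdu, h]
    simpa using iteratedDeriv_succ_id_mul_zero hf 0
  rw [key hX hx₁ hx, key hY hy₁ hy] at hXY
  have hw₀ : (fun t => pdw (fun u w => H (u, w)) t 0) =ᶠ[nhds 0] fun t =>
      t * (2 * ε₁ * x₁ t * M (t, 0) + t ^ 2 * (4 * ε₂ * y₁ t ^ 3 * N (t, 0))) := by
    filter_upwards [ht.eventually hw] with t h
    rw [h, congrFun hx t, congrFun hy t]
    ring
  have hMt : ContDiff ℝ (⊤ : ℕ∞) fun t : ℝ => M (t, 0) := hMc.comp (by fun_prop)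
  have hNt : ContDiff ℝ (⊤ : ℕ∞) fun t : ℝ => N (t, 0) := hNc.comp (by fun_prop)
  have hc : pd 0 2 (fun u w => H (u, w)) 0 0 = 2 * ε₁ * M (0, 0) ^ 2 := by
    have h1 : pd 0 2 (fun u w => H (u, w)) 0 0 =
        deriv (fun t => pdw (fun u w => H (u, w)) 0 t) 0 := rfl
    have h2 : (fun t => pdw (fun u w => H (u, w)) 0 t) =ᶠ[nhds 0] _ := ht'.eventually hw
    have e1 : HasDerivAt (fun t => X (0, t)) (M (0, 0)) 0 :=
      (hXd (0, 0)).hasFDerivAt.comp_hasDerivAt (0 : ℝ)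
        ((hasDerivAt_const 0 0).prodMk (hasDerivAt_id 0))
    have e2 : HasDerivAt (fun t => Y (0, t)) (N (0, 0)) 0 :=
      (hYd (0, 0)).hasFDerivAt.comp_hasDerivAt (0 : ℝ)
        ((hasDerivAt_const 0 0).prodMk (hasDerivAt_id 0))
    have e3 : DifferentiableAt ℝ (fun t => M (0, t)) 0 :=
      (hMc.comp (by fun_prop : ContDiff ℝ (⊤ : ℕ∞) fun t : ℝ => ((0 : ℝ), t))).differentiable
        (by simp) 0
    have e4 : DifferentiableAt ℝ (fun t => N (0, t)) 0 :=
      (hNc.comp (by fun_prop : ContDiff ℝ (⊤ : ℕ∞) fun t : ℝ => ((0 : ℝ), t))).differentiable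
        (by simp) 0
    rw [h1, h2.deriv_eq]
    refine (((e1.const_mul (2 * ε₁)).mul e3.hasDerivAt).add
      (((e2.pow 3).const_mul (4 * ε₂)).mul e4.hasDerivAt)).deriv.trans ?_
    simp [hX0, hY0]
    ring
  have hM0 : M (0, 0) ≠ 0 := fun h => h02 (by simp [hc, h])
  have hε₁0 : ε₁ ≠ 0 := by rcases hε₁ with rfl | rfl <;> norm_num
  have hx₁0 : x₁ 0 = 0 := by
    rw [pd_eq_pd_pdw, pd_zero_right, hw₀.iteratedDeriv_eq, iteratedDeriv_succ_id_mul_zero (by fun_prop)]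
      at h11
    simpa [hε₁0, hM0] using h11
  obtain ⟨x₂, hx₂, rfl⟩ := exists_contDiff_eq_mul hx₁ hx₁0
  have hw₁ : (fun t => pdw (fun u w => H (u, w)) t 0) =ᶠ[nhds 0] fun t =>
      t ^ 2 * (2 * ε₁ * x₂ t * M (t, 0) + t * (4 * ε₂ * y₁ t ^ 3 * N (t, 0))) :=
    hw₀.trans (Filter.Eventually.of_forall fun t => by ring)
  have hd : pd 2 1 (fun u w => H (u, w)) 0 0 = 4 * ε₁ * x₂ 0 * M (0, 0) := by
    rw [pd_eq_pd_pdw, pd_zero_right, hw₁.iteratedDeriv_eq, (iteratedDeriv_pow_mul_zero (by fun_prop) 2).2]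
    simp [Nat.factorial]
    ring
  have hu : (fun t => H (t, 0)) =ᶠ[nhds 0] fun t => c₀ + t ^ 4 * (ε₁ * x₂ t ^ 2 + ε₂ * y₁ t ^ 4) := by
    filter_upwards [ht.eventually hHXY] with t h
    rw [h, congrFun hx t, congrFun hy t]
    ring
  have hp := iteratedDeriv_pow_mul_zero
    (by fun_prop : ContDiff ℝ (⊤ : ℕ∞) fun t => ε₁ * x₂ t ^ 2 + ε₂ * y₁ t ^ 4) 4
  have hi : ∀ i, 0 < i → pd i 0 (fun u w => H (u, w)) 0 0 =
      iteratedDeriv i (fun t => t ^ 4 * (ε₁ * x₂ t ^ 2 + ε₂ * y₁ t ^ 4)) 0 := by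
    intro i hi
    rw [pd_zero_right, hu.iteratedDeriv_eq, iteratedDeriv_const_add hi]
  refine ⟨by rw [hi 2 (by norm_num), hp.1 2 (by norm_num)],
    by rw [hi 3 (by norm_num), hp.1 3 (by norm_num)], ?_⟩
  have hy0 : y₁ 0 ≠ 0 := hXY (by simp)
  have hval : pd 4 0 (fun u w => H (u, w)) 0 0 * pd 0 2 (fun u w => H (u, w)) 0 0 -
      3 * pd 2 1 (fun u w => H (u, w)) 0 0 ^ 2 = 48 * (ε₁ * ε₂ * y₁ 0 ^ 4 * M (0, 0) ^ 2) := by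
    rw [hi 4 (by norm_num), hp.2, hc, hd]
    simp [Nat.factorial]
    ring
  have hε₂0 : ε₂ ≠ 0 := by rcases hε₂ with rfl | rfl <;> norm_num
  rw [hval]
  positivity

theorem pd_conditions_of_hasAkSingAt {H : ℝ × ℝ → ℝ} (hH : ContDiff ℝ (⊤ : ℕ∞) H)
    (h11 : pd 1 1 (fun u w => H (u, w)) 0 0 = 0) (h02 : pd 0 2 (fun u w => H (u, w)) 0 0 ≠ 0)
    (hA : HasAkSingAt (fun u w => H (u, w)) 3) :
    pd 2 0 (fun u w => H (u, w)) 0 0 = 0 ∧ pd 3 0 (fun u w => H (u, w)) 0 0 = 0 ∧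
      pd 4 0 (fun u w => H (u, w)) 0 0 * pd 0 2 (fun u w => H (u, w)) 0 0 -
        3 * pd 2 1 (fun u w => H (u, w)) 0 0 ^ 2 ≠ 0 := by
  obtain ⟨U, V, φ, ψ, ε₁, ε₂, hU, hV, h0U, h0V, hφ, hψ, -, hVU, hl, hr, hφ0, hε₁, hε₂, hh⟩ := hA
  obtain ⟨Ψ, hΨ, hΨψ⟩ := exists_contDiff_eventuallyEq hV h0V hψ
  have hψ0 : ψ (0, 0) = (0, 0) := by simpa [hφ0] using hl _ h0U
  have hΨ0 : Ψ (0, 0) = (0, 0) := hΨψ.eq_of_nhds.trans hψ0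
  have hΨd := (hΨ.differentiable (by simp)) (0, 0)
  refine pd_conditions_of_eventuallyEq hH (contDiff_fst.comp hΨ) (contDiff_snd.comp hΨ)
    (by simp [hΨ0]) (by simp [hΨ0]) hε₁ hε₂ (c₀ := H (0, 0)) ?_ (fun h1 h2 => ?_) h11 h02
  · filter_upwards [hΨψ, hV.mem_nhds h0V] with z hz hzV
    have := hh (ψ z) (hVU hzV)
    rw [hr z hzV] at this
    simpa [hz] using this
  · have hφd : HasFDerivAt φ (fderiv ℝ φ (0, 0)) (Ψ (0, 0)) := by
      rw [hΨ0]
      exact ((hφ.contDiffAt (hU.mem_nhds h0U)).differentiableAt (by simp)).hasFDerivAt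
    have hid : (fun z => φ (Ψ z)) =ᶠ[nhds (0, 0)] fun z => z := by
      filter_upwards [hΨψ, hV.mem_nhds h0V] with z hz hzV
      rw [hz, hr z hzV]
    have hc := (hφd.comp (0, 0) hΨd.hasFDerivAt).unique
      ((hasFDerivAt_id (𝕜 := ℝ) ((0 : ℝ), (0 : ℝ))).congr_of_eventuallyEq hid)
    have h3 : fderiv ℝ Ψ (0, 0) (1, 0) = 0 := by
      have e1 : fderiv ℝ (Prod.fst ∘ Ψ) (0, 0) = _ := hΨd.hasFDerivAt.fst.fderiv
      have e2 : fderiv ℝ (Prod.snd ∘ Ψ) (0, 0) = _ := hΨd.hasFDerivAt.snd.fderiv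
      rw [e1] at h1
      rw [e2] at h2
      exact Prod.ext h1 h2
    have := congrArg (fun L : ℝ × ℝ →L[ℝ] ℝ × ℝ => L (1, 0)) hc
    simp [h3, Prod.ext_iff] at this

/-- The inverse function theorem, with a smooth inverse between open sets. -/
theorem exists_smooth_inverse {E : Type*} [NormedAddCommGroup E] [NormedSpace ℝ E]
    [CompleteSpace E] {f : E → E} (hf : ContDiff ℝ (⊤ : ℕ∞) f) {x : E} {L : E ≃L[ℝ] E}
    (hL : HasFDerivAt f (L : E →L[ℝ] E) x) {O : Set E} (hO : O ∈ nhds x) :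
    ∃ (U V : Set E) (φ : E → E), IsOpen U ∧ IsOpen V ∧ f x ∈ U ∧ x ∈ V ∧ V ⊆ O ∧
      ContDiffOn ℝ (⊤ : ℕ∞) φ U ∧ MapsTo φ U V ∧ MapsTo f V U ∧
      (∀ y ∈ U, f (φ y) = y) ∧ ∀ y ∈ V, φ (f y) = y := by
  have hn : ((⊤ : ℕ∞) : WithTop ℕ∞) ≠ 0 := by simp
  let R : Set E := {y | fderiv ℝ f y ∈ range ((↑) : (E ≃L[ℝ] E) → E →L[ℝ] E)}
  have hR : IsOpen R := ContinuousLinearEquiv.isOpen.preimage (hf.continuous_fderiv hn)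
  have hxR : x ∈ R := ⟨L, hL.fderiv.symm⟩
  let e := (hf.contDiffAt.toOpenPartialHomeomorph f hL hn).restrOpen (R ∩ interior O)
    (hR.inter isOpen_interior)
  have hxe : x ∈ e.source :=
    ⟨hf.contDiffAt.mem_toOpenPartialHomeomorph_source hL hn, hxR, mem_interior_iff_mem_nhds.2 hO⟩
  refine ⟨e.target, e.source, e.symm, e.open_target, e.open_source, e.map_source hxe, hxe,
    fun y hy => interior_subset hy.2.2, fun y hy => ContDiffAt.contDiffWithinAt ?_,
    fun y hy => e.map_target hy, fun y hy => e.map_source hy, fun y hy => e.right_inv hy,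
    fun y hy => e.left_inv hy⟩
  obtain ⟨L', hL'⟩ := (e.map_target hy).2.1
  refine e.contDiffAt_symm hy (f₀' := L') ?_ hf.contDiffAt
  rw [hL']
  exact ((hf.differentiable hn) _).hasFDerivAt

/-- Completing the square: sufficient conditions on partial derivatives for an `A₃` singularity. -/
theorem hasAkSingAt_of_pd_conditions {H : ℝ × ℝ → ℝ} (hH : ContDiff ℝ (⊤ : ℕ∞) H)
    (h10 : pd 1 0 (fun u w => H (u, w)) 0 0 = 0) (h01 : pd 0 1 (fun u w => H (u, w)) 0 0 = 0)
    (h11 : pd 1 1 (fun u w => H (u, w)) 0 0 = 0) (h02 : pd 0 2 (fun u w => H (u, w)) 0 0 ≠ 0)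
    (h20 : pd 2 0 (fun u w => H (u, w)) 0 0 = 0) (h30 : pd 3 0 (fun u w => H (u, w)) 0 0 = 0)
    (h4 : pd 4 0 (fun u w => H (u, w)) 0 0 * pd 0 2 (fun u w => H (u, w)) 0 0 -
        3 * pd 2 1 (fun u w => H (u, w)) 0 0 ^ 2 ≠ 0) :
    HasAkSingAt (fun u w => H (u, w)) 3 := by
  obtain ⟨g, hg, hHg⟩ := exists_contDiff_eq_add_mul hH
  obtain ⟨K, hK, hgK⟩ := exists_contDiff_eq_add_mul hg
  have hHt : ContDiff ℝ (⊤ : ℕ∞) (fun t : ℝ => H (t, 0)) := hH.comp (by fun_prop)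
  have hgu : ContDiff ℝ (⊤ : ℕ∞) (fun t : ℝ => g (t, 0)) := hg.comp (by fun_prop)
  have hgw : ContDiff ℝ (⊤ : ℕ∞) (fun t : ℝ => g (0, t)) := hg.comp (by fun_prop)
  have hKw : ContDiff ℝ (⊤ : ℕ∞) (fun t : ℝ => K (0, t)) := hK.comp (by fun_prop)
  have hpdw : ∀ u, (fun t => H (u, t)) = fun t => H (u, 0) + t * g (u, t) := fun u =>
    funext (hHg u)
  have hg0 : ∀ u, pdw (fun u w => H (u, w)) u 0 = g (u, 0) := by
    intro u
    have h1 : ContDiff ℝ (⊤ : ℕ∞) (fun t : ℝ => g (u, t)) := hg.comp (by fun_prop)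
    have := iteratedDeriv_succ_id_mul_zero h1 0
    rw [pdw, hpdw, deriv_const_add]
    simpa using this
  have hc : pd 0 2 (fun u w => H (u, w)) 0 0 = 2 * K (0, 0) := by
    have h1 : pd 0 2 (fun u w => H (u, w)) 0 0 = iteratedDeriv 2 (fun t => H (0, t)) 0 := by
      rw [iteratedDeriv_succ, iteratedDeriv_one]
      rfl
    have h2 := iteratedDeriv_succ_id_mul_zero hgw 1
    have h3 : (fun t => g (0, t)) = fun t => g (0, 0) + t * K (0, t) := funext (hgK 0)
    have h4 := iteratedDeriv_succ_id_mul_zero hKw 0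
    rw [h1, hpdw, iteratedDeriv_const_add (by norm_num), h2, h3,
      iteratedDeriv_const_add (by norm_num), h4]
    norm_num
  have hgi : ∀ i, pd i 1 (fun u w => H (u, w)) 0 0 = iteratedDeriv i (fun t => g (t, 0)) 0 := by
    intro i
    rw [pd_eq_pd_pdw, pd_zero_right, funext hg0]
  obtain ⟨β, hβ, hgβ⟩ := exists_contDiff_eq_pow_mul hgu 2 fun i hi => by
    rw [← hgi]
    interval_cases i <;> assumption
  obtain ⟨α, hα, hHα⟩ := exists_contDiff_eq_pow_mul (hHt.sub (contDiff_const (c := H (0, 0)))) 4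
    fun i hi => by
      rcases Nat.eq_zero_or_pos i with rfl | hi'
      · simp
      · have := pd_zero_right (fun u w => H (u, w)) i 0 0
        simp only [sub_eq_neg_add]
        rw [iteratedDeriv_const_add hi', ← this]
        interval_cases i <;> assumption
  have hd : pd 2 1 (fun u w => H (u, w)) 0 0 = 2 * β 0 := by
    rw [hgi, hgβ, (iteratedDeriv_pow_mul_zero hβ 2).2]
    simp
  have he : pd 4 0 (fun u w => H (u, w)) 0 0 = 24 * α 0 := by
    have h1 := pd_zero_right (fun u w => H (u, w)) 4 0 0
    have h2 : (fun t => H (t, 0)) = fun t => H (0, 0) + t ^ 4 * α t :=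
      funext fun t => by linarith [congrFun hHα t]
    rw [h1, h2, iteratedDeriv_const_add (by norm_num), (iteratedDeriv_pow_mul_zero hα 4).2]
    simp [Nat.factorial]
  have hK0 : K (0, 0) ≠ 0 := fun h => h02 (by simp [hc, h])
  let S : ℝ × ℝ → ℝ := fun z => α z.1 - β z.1 ^ 2 / (4 * K z)
  have hS0 : S (0, 0) ≠ 0 := by
    intro h
    apply h4
    have : α 0 = β 0 ^ 2 / (4 * K (0, 0)) := sub_eq_zero.1 h
    rw [hc, hd, he, this]
    field_simp
    ring
  have hform : ∀ z : ℝ × ℝ, K z ≠ 0 → H z = H (0, 0) +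
      K z * (z.2 + z.1 ^ 2 * (β z.1 / (2 * K z))) ^ 2 + z.1 ^ 4 * S z := by
    rintro ⟨u, w⟩ hz
    have h1 := congrFun hHα u
    have h2 := congrFun hgβ u
    rw [hHg, hgK, h2]
    simp only [S]
    field_simp
    linear_combination 16 * K (u, w) * h1
  obtain ⟨ε₁, hε₁, hε₁K⟩ : ∃ ε : ℝ, (ε = 1 ∨ ε = -1) ∧ 0 < ε * K (0, 0) := by
    rcases hK0.lt_or_gt with h | h
    · exact ⟨-1, Or.inr rfl, by linarith⟩
    · exact ⟨1, Or.inl rfl, by linarith⟩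
  obtain ⟨ε₂, hε₂, hε₂S⟩ : ∃ ε : ℝ, (ε = 1 ∨ ε = -1) ∧ 0 < ε * S (0, 0) := by
    rcases hS0.lt_or_gt with h | h
    · exact ⟨-1, Or.inr rfl, by linarith⟩
    · exact ⟨1, Or.inl rfl, by linarith⟩
  have hε₁sq : ε₁ * ε₁ = 1 := by rcases hε₁ with rfl | rfl <;> norm_num
  have hε₂sq : ε₂ * ε₂ = 1 := by rcases hε₂ with rfl | rfl <;> norm_num
  let A : ℝ × ℝ → ℝ := fun z => √(ε₁ * K z)
  let B : ℝ × ℝ → ℝ := fun z => β z.1 / (2 * K z)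
  let C : ℝ × ℝ → ℝ := fun z => √√(ε₂ * S z)
  let F : ℝ × ℝ → ℝ × ℝ := fun z => (A z * (z.2 + z.1 ^ 2 * B z), z.1 * C z)
  let T : Set (ℝ × ℝ) := {z | 0 < ε₁ * K z}
  have hT : IsOpen T := isOpen_lt continuous_const (continuous_const.mul hK.continuous)
  have hKT : ∀ z ∈ T, K z ≠ 0 := fun z hz h => by simp [T, h] at hz
  have hST : ∀ z ∈ T, ContDiffAt ℝ (⊤ : ℕ∞) S z := fun z hz =>
    ((hα.comp contDiff_fst).contDiffAt).sub
      (((hβ.comp contDiff_fst).contDiffAt.pow 2).div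
        (contDiffAt_const.mul hK.contDiffAt) (by simpa using hKT z hz))
  let W : Set (ℝ × ℝ) := T ∩ {z | 0 < ε₂ * S z}
  have hW : IsOpen W := by
    refine isOpen_iff_mem_nhds.2 fun z hz => ?_
    refine Filter.inter_mem (hT.mem_nhds hz.1) ?_
    exact (continuousAt_const.mul (hST z hz.1).continuousAt).eventually_const_lt hz.2
  have h0W : ((0 : ℝ), (0 : ℝ)) ∈ W := ⟨hε₁K, hε₂S⟩
  have hA : ∀ z ∈ W, ContDiffAt ℝ (⊤ : ℕ∞) A z := fun z hz =>
    (contDiffAt_const.mul hK.contDiffAt).sqrt hz.1.ne'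
  have hB : ∀ z ∈ W, ContDiffAt ℝ (⊤ : ℕ∞) B z := fun z hz =>
    ((hβ.comp contDiff_fst).contDiffAt).div (contDiffAt_const.mul hK.contDiffAt)
      (by simpa using hKT z hz.1)
  have hC : ∀ z ∈ W, ContDiffAt ℝ (⊤ : ℕ∞) C z := fun z hz =>
    ((contDiffAt_const.mul (hST z hz.1)).sqrt hz.2.ne').sqrt (Real.sqrt_pos.2 hz.2).ne'
  have hF : ContDiffOn ℝ (⊤ : ℕ∞) F W := fun z hz => ContDiffAt.contDiffWithinAt <|
    ((hA z hz).mul (contDiff_snd.contDiffAt.add ((contDiff_fst.contDiffAt.pow 2).mul (hB z hz)))).prodMk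
      (contDiff_fst.contDiffAt.mul (hC z hz))
  obtain ⟨Ψ, hΨ, hΨF⟩ := exists_contDiff_eventuallyEq hW h0W hF
  have hA0 : A (0, 0) ≠ 0 := (Real.sqrt_pos.2 hε₁K).ne'
  have hC0 : C (0, 0) ≠ 0 := (Real.sqrt_pos.2 (Real.sqrt_pos.2 hε₂S)).ne'
  let L : (ℝ × ℝ) ≃L[ℝ] ℝ × ℝ :=
    (ContinuousLinearEquiv.prodComm ℝ ℝ ℝ).trans
      ((ContinuousLinearEquiv.unitsEquivAut ℝ (Units.mk0 _ hA0)).prodCongr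
        (ContinuousLinearEquiv.unitsEquivAut ℝ (Units.mk0 _ hC0)))
  have hL : HasFDerivAt Ψ (L : ℝ × ℝ →L[ℝ] ℝ × ℝ) (0, 0) := by
    refine HasFDerivAt.congr_of_eventuallyEq ?_ hΨF
    have a1 := ((hA _ h0W).differentiableAt (by simp)).hasFDerivAt
    have b1 := ((hB _ h0W).differentiableAt (by simp)).hasFDerivAt
    have c1 := ((hC _ h0W).differentiableAt (by simp)).hasFDerivAt
    have p1 := hasFDerivAt_fst (𝕜 := ℝ) (p := ((0 : ℝ), (0 : ℝ)))
    have p2 := hasFDerivAt_snd (𝕜 := ℝ) (p := ((0 : ℝ), (0 : ℝ)))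
    refine ((a1.mul (p2.add ((p1.pow 2).mul b1))).prodMk (p1.mul c1)).congr_fderiv ?_
    ext <;> simp [L]
  have hO : {z | z ∈ W ∧ Ψ z = F z} ∈ nhds ((0 : ℝ), (0 : ℝ)) :=
    Filter.inter_mem (hW.mem_nhds h0W) hΨF
  obtain ⟨U, V, φ, hU, hV, h0U, h0V, hVO, hφ, hUV, hVU, hr, hl⟩ := exists_smooth_inverse hΨ hL hO
  have hΨ0 : Ψ (0, 0) = (0, 0) := hΨF.eq_of_nhds.trans (by simp [F])
  refine ⟨U, V, φ, Ψ, ε₁, ε₂, hU, hV, hΨ0 ▸ h0U, h0V, hφ, hΨ.contDiffOn, hUV, hVU, hr, hl, ?_,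
    hε₁, hε₂, fun x hx => ?_⟩
  · simpa [hΨ0] using hl _ h0V
  · obtain ⟨⟨hzT, hzS⟩, hzF⟩ := hVO (hUV hx)
    rw [hr x hx] at hzF
    have hA2 : A (φ x) ^ 2 = ε₁ * K (φ x) := Real.sq_sqrt (le_of_lt hzT)
    have hC4 : C (φ x) ^ 4 = ε₂ * S (φ x) := by
      rw [show C (φ x) ^ 4 = (C (φ x) ^ 2) ^ 2 by ring, Real.sq_sqrt (Real.sqrt_nonneg _),
        Real.sq_sqrt (le_of_lt hzS)]
    have h1 : x.1 = A (φ x) * ((φ x).2 + (φ x).1 ^ 2 * B (φ x)) := congrArg Prod.fst hzF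
    have h2 : x.2 = (φ x).1 * C (φ x) := congrArg Prod.snd hzF
    refine (hform (φ x) (hKT _ hzT)).trans ?_
    rw [h1, h2, mul_pow, mul_pow, hA2, hC4]
    linear_combination (-K (φ x) * ((φ x).2 + (φ x).1 ^ 2 * B (φ x)) ^ 2) * hε₁sq -
      ((φ x).1 ^ 4 * S (φ x)) * hε₂sq

theorem pd_linear_combination {p q : ℝ → ℝ → ℝ}
    (hp : ContDiff ℝ (⊤ : ℕ∞) fun z : ℝ × ℝ => p z.1 z.2)
    (hq : ContDiff ℝ (⊤ : ℕ∞) fun z : ℝ × ℝ => q z.1 z.2) (r s : ℝ) (i j : ℕ) :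
    pd i j (fun u w => r * p u w + s * q u w) 0 0 = r * pd i j p 0 0 + s * pd i j q 0 0 := by
  suffices h : ∀ u w, pd i j (fun u w => r * p u w + s * q u w) u w =
      r * pd i j p u w + s * pd i j q u w from h 0 0
  induction j generalizing p q with
  | zero =>
    intro u w
    have hc : ∀ {f : ℝ → ℝ → ℝ}, ContDiff ℝ (⊤ : ℕ∞) (fun z : ℝ × ℝ => f z.1 z.2) →
        ContDiffAt ℝ i (fun t => f t w) u := fun hf =>
      ((hf.comp (by fun_prop : ContDiff ℝ (⊤ : ℕ∞) fun t : ℝ => (t, w))).of_le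
        (by exact_mod_cast le_top)).contDiffAt
    rw [pd_zero_right, pd_zero_right, pd_zero_right,
      iteratedDeriv_fun_add (contDiffAt_const.mul (hc hp)) (contDiffAt_const.mul (hc hq)),
      iteratedDeriv_const_mul_field, iteratedDeriv_const_mul_field]
  | succ j ih =>
    have hd : ∀ {f : ℝ → ℝ → ℝ}, ContDiff ℝ (⊤ : ℕ∞) (fun z : ℝ × ℝ => f z.1 z.2) →
        ∀ u, Differentiable ℝ (fun t => f u t) := fun hf u =>
      (hf.comp (by fun_prop : ContDiff ℝ (⊤ : ℕ∞) fun t : ℝ => (u, t))).differentiable (by simp)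
    have h1 : pdw (fun u w => r * p u w + s * q u w) = fun u w => r * pdw p u w + s * pdw q u w := by
      ext u w
      exact (((hd hp u w).hasDerivAt.const_mul r).add ((hd hq u w).hasDerivAt.const_mul s)).deriv
    simp only [pd_eq_pd_pdw, h1]
    exact ih (contDiff_pdw hp) (contDiff_pdw hq)

/-- for `ν₀ = ±(0, −a_{n+1,1} cos θ₀/A(θ₀), (n+1)! sin θ₀/A(θ₀))`, the height
function `h_{ν₀}` has an `A₃` singularity at the origin iff `(0,θ₀)` is a parabolic point which
is a first-order ridge point over the singularity. -/
theorem height_A3_over_singularity_iff (p q : ℝ → ℝ → ℝ) (b : ℕ → ℝ) (a : ℕ → ℕ → ℝ)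
    (n : ℕ) (hn : 1 ≤ n) (hNF : NormalFormN (max 4 (n + 2)) p q b a)
    (hvan : ∀ i, 2 ≤ i → i ≤ n → a i 1 = 0) (hnz : a (n + 1) 1 ≠ 0)
    (θ₀ : ℝ) (hθ : θ₀ ∈ Set.Ioo (-(π / 2)) (π / 2)) (σ : ℝ) (hσ : σ = 1 ∨ σ = -1) :
    HasAkSingAt
      (hgt p q
        (0,
          σ * (-(a (n + 1) 1) * Real.cos θ₀ /
            Real.sqrt (a (n + 1) 1 ^ 2 * Real.cos θ₀ ^ 2 +
              (Nat.factorial (n + 1) : ℝ) ^ 2 * Real.sin θ₀ ^ 2)),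
          σ * ((Nat.factorial (n + 1) : ℝ) * Real.sin θ₀ /
            Real.sqrt (a (n + 1) 1 ^ 2 * Real.cos θ₀ ^ 2 +
              (Nat.factorial (n + 1) : ℝ) ^ 2 * Real.sin θ₀ ^ 2)))) 3 ↔
      (a (n + 1) 1 * b 2 * Real.cos θ₀ - (Nat.factorial (n + 1) : ℝ) * a 2 0 * Real.sin θ₀ = 0 ∧
        a (n + 1) 1 * b 3 * Real.cos θ₀ - (Nat.factorial (n + 1) : ℝ) * a 3 0 * Real.sin θ₀ = 0 ∧
        a (n + 1) 1 *
            (a (n + 1) 1 * b 4 * Real.cos θ₀ -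
              (Nat.factorial (n + 1) : ℝ) * a 4 0 * Real.sin θ₀) * Real.cos θ₀ -
          3 * (Nat.factorial (n + 1) : ℝ) ^ 2 * a 2 1 ^ 2 * Real.sin θ₀ ^ 2 ≠ 0) := by
  obtain ⟨hp, hq, -, -, hp10, hp01, hq10, hq01, hp02, hpb, hp0, hqa, ha11, ha02⟩ := hNF
  have hcos := Real.cos_pos_of_mem_Ioo hθ
  set m := a (n + 1) 1 with hm
  set N : ℝ := (Nat.factorial (n + 1) : ℝ) with hN
  set R := √(m ^ 2 * cos θ₀ ^ 2 + N ^ 2 * sin θ₀ ^ 2) with hR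
  have hR0 : R ≠ 0 := (Real.sqrt_pos.2 (by positivity)).ne'
  have hσ0 : σ ≠ 0 := by rcases hσ with rfl | rfl <;> norm_num
  set r := σ * (-m * cos θ₀ / R) with hr
  set s := σ * (N * sin θ₀ / R) with hs
  have hr0 : r ≠ 0 :=
    mul_ne_zero hσ0 (div_ne_zero (mul_ne_zero (neg_ne_zero.2 hnz) hcos.ne') hR0)
  let H : ℝ × ℝ → ℝ := fun z => r * p z.1 z.2 + s * q z.1 z.2
  have hH : ContDiff ℝ (⊤ : ℕ∞) H := (contDiff_const.mul hp).add (contDiff_const.mul hq)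
  have hgH : hgt p q (0, r, s) = fun u w => H (u, w) := by
    ext u w
    simp [hgt, dot3, gmap, H]
    ring
  have hb2 := hpb 2 le_rfl (by omega)
  have hb3 := hpb 3 (by omega) (by omega)
  have hb4 := hpb 4 (by omega) (by omega)
  have hq20 := hqa 2 0 (by omega) (by omega)
  have hq30 := hqa 3 0 (by omega) (by omega)
  have hq40 := hqa 4 0 (by omega) (by omega)
  have hq11 := hqa 1 1 (by omega) (by omega)
  have hq02 := hqa 0 2 (by omega) (by omega)
  have hq21 := hqa 2 1 (by omega) (by omega)
  have hp11 := hp0 1 1 (by omega) (by omega) (by omega) (by omega)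
  have hp21 := hp0 2 1 (by omega) (by omega) (by omega) (by omega)
  have hpdH : ∀ i j, pd i j (fun u w => H (u, w)) 0 0 = r * pd i j p 0 0 + s * pd i j q 0 0 :=
    pd_linear_combination hp hq r s
  rw [hgH]
  have e02 : pd 0 2 (fun u w => H (u, w)) 0 0 = r := by rw [hpdH, hp02, hq02, ha02]; ring
  have e10 : pd 1 0 (fun u w => H (u, w)) 0 0 = 0 := by rw [hpdH, hp10, hq10]; ring
  have e01 : pd 0 1 (fun u w => H (u, w)) 0 0 = 0 := by rw [hpdH, hp01, hq01]; ring
  have e11 : pd 1 1 (fun u w => H (u, w)) 0 0 = 0 := by rw [hpdH, hp11, hq11, ha11]; ring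
  have hiff : HasAkSingAt (fun u w => H (u, w)) 3 ↔
      pd 2 0 (fun u w => H (u, w)) 0 0 = 0 ∧ pd 3 0 (fun u w => H (u, w)) 0 0 = 0 ∧
      pd 4 0 (fun u w => H (u, w)) 0 0 * pd 0 2 (fun u w => H (u, w)) 0 0 -
        3 * pd 2 1 (fun u w => H (u, w)) 0 0 ^ 2 ≠ 0 :=
    ⟨pd_conditions_of_hasAkSingAt hH e11 (e02 ▸ hr0), fun ⟨h20, h30, h4⟩ =>
      hasAkSingAt_of_pd_conditions hH e10 e01 e11 (e02 ▸ hr0) h20 h30 h4⟩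
  have e2 : pd 2 0 (fun u w => H (u, w)) 0 0 =
      (-σ / R) * (m * b 2 * cos θ₀ - N * a 2 0 * sin θ₀) := by
    rw [hpdH, hb2, hq20, hr, hs]; ring
  have e3 : pd 3 0 (fun u w => H (u, w)) 0 0 =
      (-σ / R) * (m * b 3 * cos θ₀ - N * a 3 0 * sin θ₀) := by
    rw [hpdH, hb3, hq30, hr, hs]; ring
  have e4 : pd 4 0 (fun u w => H (u, w)) 0 0 * pd 0 2 (fun u w => H (u, w)) 0 0 -
      3 * pd 2 1 (fun u w => H (u, w)) 0 0 ^ 2 =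
      (σ ^ 2 / R ^ 2) * (m * (m * b 4 * cos θ₀ - N * a 4 0 * sin θ₀) * cos θ₀ -
        3 * N ^ 2 * a 2 1 ^ 2 * sin θ₀ ^ 2) := by
    rw [e02, hpdH, hpdH, hb4, hq40, hp21, hq21, hr, hs]; ring
  have hk : -σ / R ≠ 0 := div_ne_zero (neg_ne_zero.2 hσ0) hR0
  have hk2 : σ ^ 2 / R ^ 2 ≠ 0 := div_ne_zero (pow_ne_zero 2 hσ0) (pow_ne_zero 2 hR0)
  rw [hiff, e2, e3, e4, mul_eq_zero_iff_left hk, mul_eq_zero_iff_left hk, mul_ne_zero_iff,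
    and_iff_right hk2]
end
end

section
/- Let g be in normal form. Then the parabolic-set function Σ satisfies: Σ and all its partial derivatives of order ≤ 2 vanish at (0,0), and its third-order partial derivatives at (0,0) are ∂_u³Σ(0,0) = 0, ∂_u²∂_wΣ(0,0) = −a_{2,0} a_{2,1}, ∂_u∂_w²Σ(0,0) = 0, and ∂_w³Σ(0,0) = 3 a_{2,0} a_{0,3}. -/
open Real Set

noncomputable section

/-- The two-variable function `f` is of class `C^∞`. -/
def Smooth₂ (f : ℝ → ℝ → ℝ) : Prop := ContDiff ℝ (⊤ : ℕ∞) (fun x : ℝ × ℝ => f x.1 x.2)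

namespace Smooth₂

variable {f g : ℝ → ℝ → ℝ}

theorem const (c : ℝ) : Smooth₂ (fun _ _ => c) := contDiff_const

theorem fst : Smooth₂ (fun u _ => u) := contDiff_fst

theorem mul (hf : Smooth₂ f) (hg : Smooth₂ g) : Smooth₂ (f * g) := ContDiff.mul hf hg

theorem add (hf : Smooth₂ f) (hg : Smooth₂ g) : Smooth₂ (f + g) := ContDiff.add hf hg

theorem sub (hf : Smooth₂ f) (hg : Smooth₂ g) : Smooth₂ (f - g) := ContDiff.sub hf hg

theorem differentiable (hf : Smooth₂ f) : Differentiable ℝ (fun x : ℝ × ℝ => f x.1 x.2) :=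
  ContDiff.differentiable hf (by simp)

theorem hasDerivAt_fst (hf : Smooth₂ f) (u w : ℝ) :
    HasDerivAt (fun t => f t w) (fderiv ℝ (fun x : ℝ × ℝ => f x.1 x.2) (u, w) (1, 0)) u :=
  (hf.differentiable (u, w)).hasFDerivAt.comp_hasDerivAt (f := fun t : ℝ => (t, w)) u
    ((hasDerivAt_id u).prodMk (hasDerivAt_const u w))

theorem hasDerivAt_snd (hf : Smooth₂ f) (u w : ℝ) :
    HasDerivAt (fun t => f u t) (fderiv ℝ (fun x : ℝ × ℝ => f x.1 x.2) (u, w) (0, 1)) w :=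
  (hf.differentiable (u, w)).hasFDerivAt.comp_hasDerivAt (f := fun t : ℝ => (u, t)) w
    ((hasDerivAt_const w u).prodMk (hasDerivAt_id w))

theorem pdu_eq (hf : Smooth₂ f) :
    pdu f = fun u w => fderiv ℝ (fun x : ℝ × ℝ => f x.1 x.2) (u, w) (1, 0) :=
  funext₂ fun u w => (hf.hasDerivAt_fst u w).deriv

theorem pdw_eq (hf : Smooth₂ f) :
    pdw f = fun u w => fderiv ℝ (fun x : ℝ × ℝ => f x.1 x.2) (u, w) (0, 1) :=
  funext₂ fun u w => (hf.hasDerivAt_snd u w).deriv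

theorem contDiff_fderiv (hf : Smooth₂ f) :
    ContDiff ℝ (⊤ : ℕ∞) (fderiv ℝ (fun x : ℝ × ℝ => f x.1 x.2)) :=
  ContDiff.fderiv_right hf (by simp)

theorem pdu (hf : Smooth₂ f) : Smooth₂ (pdu f) := by
  rw [hf.pdu_eq]
  exact hf.contDiff_fderiv.clm_apply contDiff_const

theorem pdw (hf : Smooth₂ f) : Smooth₂ (pdw f) := by
  rw [hf.pdw_eq]
  exact hf.contDiff_fderiv.clm_apply contDiff_const

theorem hasDerivAt_pdu (hf : Smooth₂ f) (u w : ℝ) :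
    HasDerivAt (fun t => f t w) (_root_.pdu f u w) u :=
  (hf.hasDerivAt_fst u w).differentiableAt.hasDerivAt

theorem hasDerivAt_pdw (hf : Smooth₂ f) (u w : ℝ) :
    HasDerivAt (fun t => f u t) (_root_.pdw f u w) w :=
  (hf.hasDerivAt_snd u w).differentiableAt.hasDerivAt

end Smooth₂

section Rules

variable {f g h : ℝ → ℝ → ℝ}

theorem pdw_pdu_comm (hf : Smooth₂ f) : pdw (pdu f) = pdu (pdw f) := by
  rw [hf.pdu.pdw_eq, hf.pdw.pdu_eq]
  funext u w
  have hd : DifferentiableAt ℝ (fderiv ℝ (fun x : ℝ × ℝ => f x.1 x.2)) (u, w) :=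
    hf.contDiff_fderiv.differentiable (by simp) (u, w)
  have hsymm : IsSymmSndFDerivAt ℝ (fun x : ℝ × ℝ => f x.1 x.2) (u, w) :=
    (ContDiff.contDiffAt hf).isSymmSndFDerivAt
      (by
        rw [minSmoothness_of_isRCLikeNormedField]
        exact WithTop.coe_le_coe.2 (le_top (a := (2 : ℕ∞))))
  simp only [hf.pdu_eq, hf.pdw_eq, Prod.mk.eta]
  rw [fderiv_clm_apply hd (differentiableAt_const _), fderiv_clm_apply hd (differentiableAt_const _)]
  simpa using hsymm (0, 1) (1, 0)

theorem pdu_mul (hf : Smooth₂ f) (hg : Smooth₂ g) : pdu (f * g) = pdu f * g + f * pdu g :=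
  funext₂ fun u w => ((hf.hasDerivAt_pdu u w).mul (hg.hasDerivAt_pdu u w)).deriv

theorem pdw_mul (hf : Smooth₂ f) (hg : Smooth₂ g) : pdw (f * g) = pdw f * g + f * pdw g :=
  funext₂ fun u w => ((hf.hasDerivAt_pdw u w).mul (hg.hasDerivAt_pdw u w)).deriv

theorem pdu_add (hf : Smooth₂ f) (hg : Smooth₂ g) : pdu (f + g) = pdu f + pdu g :=
  funext₂ fun u w => ((hf.hasDerivAt_pdu u w).add (hg.hasDerivAt_pdu u w)).deriv

theorem pdw_add (hf : Smooth₂ f) (hg : Smooth₂ g) : pdw (f + g) = pdw f + pdw g :=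
  funext₂ fun u w => ((hf.hasDerivAt_pdw u w).add (hg.hasDerivAt_pdw u w)).deriv

theorem pdu_sub (hf : Smooth₂ f) (hg : Smooth₂ g) : pdu (f - g) = pdu f - pdu g :=
  funext₂ fun u w => ((hf.hasDerivAt_pdu u w).sub (hg.hasDerivAt_pdu u w)).deriv

theorem pdw_sub (hf : Smooth₂ f) (hg : Smooth₂ g) : pdw (f - g) = pdw f - pdw g :=
  funext₂ fun u w => ((hf.hasDerivAt_pdw u w).sub (hg.hasDerivAt_pdw u w)).deriv

theorem pdu_prodMk (hf : Smooth₂ f) (hg : Smooth₂ g) (hh : Smooth₂ h) :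
    pdu (fun u w => (f u w, g u w, h u w)) = fun u w => (pdu f u w, pdu g u w, pdu h u w) :=
  funext₂ fun u w => ((hf.hasDerivAt_pdu u w).prodMk
    ((hg.hasDerivAt_pdu u w).prodMk (hh.hasDerivAt_pdu u w))).deriv

theorem pdw_prodMk (hf : Smooth₂ f) (hg : Smooth₂ g) (hh : Smooth₂ h) :
    pdw (fun u w => (f u w, g u w, h u w)) = fun u w => (pdw f u w, pdw g u w, pdw h u w) :=
  funext₂ fun u w => ((hf.hasDerivAt_pdw u w).prodMk
    ((hg.hasDerivAt_pdw u w).prodMk (hh.hasDerivAt_pdw u w))).deriv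

theorem pdu_const (c : ℝ) : pdu (fun _ _ => c) = fun _ _ => (0 : ℝ) :=
  funext₂ fun u _ => deriv_const u c

theorem pdw_const (c : ℝ) : pdw (fun _ _ => c) = fun _ _ => (0 : ℝ) :=
  funext₂ fun _ w => deriv_const w c

theorem pdu_fst : pdu (fun u _ => u) = fun _ _ => (1 : ℝ) :=
  funext₂ fun u _ => deriv_id u

theorem pdw_fst : pdw (fun u _ => u) = fun _ _ => (0 : ℝ) :=
  funext₂ fun u w => deriv_const w u

end Rules

/-- For `g = (u, p, q)`, the inner product of `(0, r, s)` with `g_u × g_w`. -/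
def normalPart (p q r s : ℝ → ℝ → ℝ) : ℝ → ℝ → ℝ := s * pdw p - r * pdw q

theorem SigmaFun_eq {p q : ℝ → ℝ → ℝ} (hp : Smooth₂ p) (hq : Smooth₂ q) :
    SigmaFun p q =
      normalPart p q (pdu (pdu p)) (pdu (pdu q)) * normalPart p q (pdw (pdw p)) (pdw (pdw q)) -
        normalPart p q (pdu (pdw p)) (pdu (pdw q)) * normalPart p q (pdu (pdw p)) (pdu (pdw q)) := by
  have hu : pdu (gmap p q) = fun u w => (1, pdu p u w, pdu q u w) := by
    unfold gmap
    rw [pdu_prodMk .fst hp hq, pdu_fst]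
  have hw : pdw (gmap p q) = fun u w => (0, pdw p u w, pdw q u w) := by
    unfold gmap
    rw [pdw_prodMk .fst hp hq, pdw_fst]
  have huu : pdu (fun u w => ((1 : ℝ), pdu p u w, pdu q u w)) =
      fun u w => (0, pdu (pdu p) u w, pdu (pdu q) u w) := by
    rw [pdu_prodMk (.const 1) hp.pdu hq.pdu, pdu_const]
  have huw : pdu (fun u w => ((0 : ℝ), pdw p u w, pdw q u w)) =
      fun u w => (0, pdu (pdw p) u w, pdu (pdw q) u w) := by
    rw [pdu_prodMk (.const 0) hp.pdw hq.pdw, pdu_const]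
  have hww : pdw (fun u w => ((0 : ℝ), pdw p u w, pdw q u w)) =
      fun u w => (0, pdw (pdw p) u w, pdw (pdw q) u w) := by
    rw [pdw_prodMk (.const 0) hp.pdw hq.pdw, pdw_const]
  funext u w
  simp only [SigmaFun, pd, Function.iterate_succ, Function.iterate_zero, Function.comp_apply,
    id_eq, hu, hw, huu, huw, hww, dot3, cross3, normalPart, Pi.sub_apply, Pi.mul_apply]
  ring

/-- The three-jet at the origin of `E * A - B * B`, when `E` and `B` vanish there and `A`, `B`
vanish to first order. -/
theorem three_jet_mul_sub_mul {E A B : ℝ → ℝ → ℝ}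
    (hE : Smooth₂ E) (hA : Smooth₂ A) (hB : Smooth₂ B)
    (E0 : E 0 0 = 0) (A0 : A 0 0 = 0) (Au : pdu A 0 0 = 0) (Aw : pdw A 0 0 = 0)
    (B0 : B 0 0 = 0) (Bu : pdu B 0 0 = 0) (Bw : pdw B 0 0 = 0) :
    (∀ i j, i + j ≤ 2 → pd i j (E * A - B * B) 0 0 = 0) ∧
    pd 3 0 (E * A - B * B) 0 0 = 3 * pdu E 0 0 * pdu (pdu A) 0 0 ∧
    pd 2 1 (E * A - B * B) 0 0 =
      2 * pdu E 0 0 * pdu (pdw A) 0 0 + pdw E 0 0 * pdu (pdu A) 0 0 ∧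
    pd 1 2 (E * A - B * B) 0 0 =
      pdu E 0 0 * pdw (pdw A) 0 0 + 2 * pdw E 0 0 * pdu (pdw A) 0 0 ∧
    pd 0 3 (E * A - B * B) 0 0 = 3 * pdw E 0 0 * pdw (pdw A) 0 0 := by
  refine ⟨fun i j hij => ?_, ?_, ?_, ?_, ?_⟩
  · have hi : i ≤ 2 := by omega
    have hj : j ≤ 2 := by omega
    interval_cases i <;> interval_cases j <;> first
      | omega
      | simp (maxDischargeDepth := 8) [pd, pdu_mul, pdw_mul, pdu_add, pdw_add,
          pdu_sub, pdw_sub, Smooth₂.mul, Smooth₂.add, Smooth₂.pdu, Smooth₂.pdw, *]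
  all_goals
    simp (maxDischargeDepth := 8) [pd, pdu_mul, pdw_mul, pdu_add, pdw_add,
      pdu_sub, pdw_sub, Smooth₂.mul, Smooth₂.add, Smooth₂.pdu, Smooth₂.pdw, *]
  all_goals ring

/-- for `g` in normal form, `Σ` and all its partial derivatives of order `≤ 2`
vanish at the origin, and the third-order partial derivatives of `Σ` at the origin are
`∂_u³Σ = 0`, `∂_u²∂_wΣ = −a_{2,0} a_{2,1}`, `∂_u∂_w²Σ = 0` and `∂_w³Σ = 3 a_{2,0} a_{0,3}`. -/
theorem sigma_three_jet (p q : ℝ → ℝ → ℝ) (b : ℕ → ℝ) (a : ℕ → ℕ → ℝ)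
    (hNF : NormalFormN 4 p q b a) :
    (∀ i j, i + j ≤ 2 → pd i j (SigmaFun p q) 0 0 = 0) ∧
    pd 3 0 (SigmaFun p q) 0 0 = 0 ∧
    pd 2 1 (SigmaFun p q) 0 0 = -(a 2 0 * a 2 1) ∧
    pd 1 2 (SigmaFun p q) 0 0 = 0 ∧
    pd 0 3 (SigmaFun p q) 0 0 = 3 * a 2 0 * a 0 3 := by
  obtain ⟨hp, hq, -, -, -, p01, -, q01, p02, -, hpz, hqa, a11, a02⟩ := hNF
  change Smooth₂ p at hp
  change Smooth₂ q at hq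
  have p11 := hpz 1 1 (by norm_num) (by norm_num) (by norm_num) (by norm_num)
  have p21 := hpz 2 1 (by norm_num) (by norm_num) (by norm_num) (by norm_num)
  have p12 := hpz 1 2 (by norm_num) (by norm_num) (by norm_num) (by norm_num)
  have p03 := hpz 0 3 (by norm_num) (by norm_num) (by norm_num) (by norm_num)
  have q20 := hqa 2 0 (by norm_num) (by norm_num)
  have q11 := hqa 1 1 (by norm_num) (by norm_num)
  have q02 := hqa 0 2 (by norm_num) (by norm_num)
  have q21 := hqa 2 1 (by norm_num) (by norm_num)
  have q12 := hqa 1 2 (by norm_num) (by norm_num)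
  have q03 := hqa 0 3 (by norm_num) (by norm_num)
  rw [a11] at q11
  rw [a02] at q02
  simp only [pd, Function.iterate_succ, Function.iterate_zero, Function.comp_apply, id_eq]
    at p01 q01 p02 p11 p21 p12 p03 q20 q11 q02 q21 q12 q03
  have hN : ∀ {r s}, Smooth₂ r → Smooth₂ s → Smooth₂ (normalPart p q r s) :=
    fun hr hs => (hs.mul hp.pdw).sub (hr.mul hq.pdw)
  rw [SigmaFun_eq hp hq]
  obtain ⟨h2, h30, h21, h12, h03⟩ := three_jet_mul_sub_mul
    (hN hp.pdu.pdu hq.pdu.pdu) (hN hp.pdw.pdw hq.pdw.pdw) (hN hp.pdw.pdu hq.pdw.pdu)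
    (by simp [normalPart, *]) (by simp [normalPart, *])
    (by simp (maxDischargeDepth := 8) [normalPart, pdu_mul, pdu_sub, Smooth₂.mul,
      Smooth₂.pdw, *])
    (by simp (maxDischargeDepth := 8) [normalPart, pdw_mul, pdw_sub, Smooth₂.mul,
      Smooth₂.pdw, *])
    (by simp [normalPart, *])
    (by simp (maxDischargeDepth := 8) [normalPart, pdu_mul, pdu_sub, Smooth₂.mul,
      Smooth₂.pdu, Smooth₂.pdw, *])
    (by simp (maxDischargeDepth := 8) [normalPart, pdw_mul, pdw_sub, Smooth₂.mul,
      Smooth₂.pdu, Smooth₂.pdw, pdw_pdu_comm, *])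
  refine ⟨h2, ?_, ?_, ?_, ?_⟩
  · rw [h30]
    simp (maxDischargeDepth := 8) [normalPart, pdu_mul, pdu_sub, Smooth₂.mul, Smooth₂.pdu,
      Smooth₂.pdw, *]
  · rw [h21]
    simp (maxDischargeDepth := 8) [normalPart, pdu_mul, pdu_sub, pdu_add, pdw_mul, pdw_sub,
      Smooth₂.mul, Smooth₂.add, Smooth₂.pdu, Smooth₂.pdw, pdw_pdu_comm, *]
  · rw [h12]
    simp (maxDischargeDepth := 8) [normalPart, pdu_mul, pdu_sub, pdu_add, pdw_mul, pdw_sub,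
      Smooth₂.mul, Smooth₂.add, Smooth₂.pdu, Smooth₂.pdw, pdw_pdu_comm, *]
  · rw [h03]
    simp (maxDischargeDepth := 8) [normalPart, pdw_mul, pdw_sub, pdw_add, Smooth₂.mul,
      Smooth₂.add, Smooth₂.pdu, Smooth₂.pdw, *]
end
end
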